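/- arXiv:1505.05558 — 2 statements merged into one kernel-verified Lean document; each statement's English description precedes it below -/
import Mathlib

section
/- Let A be an n×n integer matrix and B an m×m integer matrix, and let A⊗B denote their Kronecker product, an (nm)×(nm) integer matrix with (A⊗B)_{(i,k),(j,l)} = A_{ij}·B_{kl}. Then there is an isomorphism of abelian groups D(A⊗B) ≅ D(A) ⊗_ℤ D(B) which intertwines the automorphism (A⊗B)_* of D(A⊗B) with the automorphism A_* ⊗ B_* of D(A) ⊗_ℤ D(B). -/
open Module TensorProduct

section DimGroup

variable {ι : Type} [Fintype ι] [DecidableEq ι]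

/-- The directed system `ℤ^ι –C→ ℤ^ι –C→ ⋯`, with connecting maps given by powers
of `C`. -/
noncomputable def dimSys (C : Matrix ι ι ℤ) :
    ∀ i j : ℕ, i ≤ j → (ι → ℤ) →ₗ[ℤ] (ι → ℤ) :=
  fun i j _ => (C ^ (j - i)).mulVecLin

/-- Krieger's dimension group `D(C)`: the direct limit of `ℤ^ι –C→ ℤ^ι –C→ ⋯`. -/
noncomputable def dimGroup (C : Matrix ι ι ℤ) : Type :=
  Module.DirectLimit (fun _ : ℕ => ι → ℤ) (dimSys C)

noncomputable instance (C : Matrix ι ι ℤ) : AddCommGroup (dimGroup C) :=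
  inferInstanceAs (AddCommGroup (Module.DirectLimit _ _))

noncomputable instance (C : Matrix ι ι ℤ) : Module ℤ (dimGroup C) :=
  inferInstanceAs (Module ℤ (Module.DirectLimit _ _))

/-- The map `C_* : D(C) → D(C)`, `[v, j] ↦ [C v, j]`, induced by `C` on the dimension
group. -/
noncomputable def dimShift (C : Matrix ι ι ℤ) : dimGroup C →ₗ[ℤ] dimGroup C :=
  Module.DirectLimit.lift ℤ ℕ (fun _ : ℕ => ι → ℤ) (dimSys C)
    (fun i => (Module.DirectLimit.of ℤ ℕ (fun _ : ℕ => ι → ℤ) (dimSys C) i).comp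
      C.mulVecLin)
    (by
      intro i j hij x
      have h1 : C.mulVecLin ((dimSys C) i j hij x)
          = (dimSys C) i j hij (C.mulVecLin x) := by
        simp only [dimSys]
        rw [← LinearMap.comp_apply, ← LinearMap.comp_apply,
          ← Matrix.mulVecLin_mul, ← Matrix.mulVecLin_mul,
          ((Commute.refl C).pow_right (j - i)).eq]
      show Module.DirectLimit.of ℤ ℕ (fun _ : ℕ => ι → ℤ) (dimSys C) j
          (C.mulVecLin ((dimSys C) i j hij x))
        = Module.DirectLimit.of ℤ ℕ (fun _ : ℕ => ι → ℤ) (dimSys C) i (C.mulVecLin x)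
      rw [h1, Module.DirectLimit.of_f])

end DimGroup

section PiTensor

variable {ι κ : Type} [Fintype ι] [Fintype κ]

variable (ι κ) in
/-- The identification `ℤ^ι ⊗ ℤ^κ ≃ ℤ^(ι × κ)`. -/
noncomputable def piTensorEquiv : (ι → ℤ) ⊗[ℤ] (κ → ℤ) ≃ₗ[ℤ] (ι × κ → ℤ) :=
  ((Pi.basisFun ℤ ι).tensorProduct (Pi.basisFun ℤ κ)).equivFun

theorem piTensorEquiv_tmul (x : ι → ℤ) (y : κ → ℤ) (p : ι × κ) :
    piTensorEquiv ι κ (x ⊗ₜ y) p = x p.1 * y p.2 := by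
  refine (Basis.tensorProduct_repr_tmul_apply (Pi.basisFun ℤ ι) (Pi.basisFun ℤ κ)
    x y p.1 p.2).trans ?_
  simp [mul_comm]

open Kronecker in
theorem kronecker_mulVec_piTensorEquiv_tmul (A : Matrix ι ι ℤ) (B : Matrix κ κ ℤ)
    (x : ι → ℤ) (y : κ → ℤ) :
    (A ⊗ₖ B).mulVec (piTensorEquiv ι κ (x ⊗ₜ y)) =
      piTensorEquiv ι κ (A.mulVec x ⊗ₜ B.mulVec y) := by
  ext p
  simp only [piTensorEquiv_tmul, Matrix.mulVec, dotProduct, Matrix.kroneckerMap_apply,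
    Fintype.sum_prod_type, Finset.sum_mul_sum]
  exact Finset.sum_congr rfl fun i _ => Finset.sum_congr rfl fun j _ => by ring

end PiTensor

section DimGroupTensor

variable {ι κ : Type} [Fintype ι] [DecidableEq ι] [Fintype κ] [DecidableEq κ]

/-- The class map `v ↦ [v, j]` into the dimension group. -/
noncomputable def dimGroupOf (C : Matrix ι ι ℤ) (j : ℕ) : (ι → ℤ) →ₗ[ℤ] dimGroup C :=
  Module.DirectLimit.of ℤ ℕ (fun _ : ℕ => ι → ℤ) (dimSys C) j

theorem dimGroupOf_pow_mulVec (C : Matrix ι ι ℤ) (j k : ℕ) (v : ι → ℤ) :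
    dimGroupOf C (j + k) ((C ^ k).mulVec v) = dimGroupOf C j v := by
  have h : dimGroupOf C (j + k) (dimSys C j (j + k) (Nat.le_add_right j k) v) =
      dimGroupOf C j v := Module.DirectLimit.of_f
  simpa [dimSys] using h

theorem dimShift_dimGroupOf (C : Matrix ι ι ℤ) (j : ℕ) (v : ι → ℤ) :
    dimShift C (dimGroupOf C j v) = dimGroupOf C j (C.mulVec v) :=
  Module.DirectLimit.lift_of _ _ _

theorem dimGroup_hom_ext {C : Matrix ι ι ℤ} {M : Type*} [AddCommGroup M] [Module ℤ M]
    {f g : dimGroup C →ₗ[ℤ] M}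
    (h : ∀ j, f ∘ₗ dimGroupOf C j = g ∘ₗ dimGroupOf C j) : f = g :=
  Module.DirectLimit.hom_ext h

/-- The universal property of the dimension group. -/
noncomputable def dimGroupLift (C : Matrix ι ι ℤ) {M : Type*} [AddCommGroup M] [Module ℤ M]
    (f : ℕ → (ι → ℤ) →ₗ[ℤ] M)
    (hf : ∀ j k v, f (j + k) ((C ^ k).mulVec v) = f j v) : dimGroup C →ₗ[ℤ] M :=
  Module.DirectLimit.lift ℤ ℕ (fun _ : ℕ => ι → ℤ) (dimSys C) f (by
    intro i j hij v
    obtain ⟨k, rfl⟩ := Nat.exists_eq_add_of_le hij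
    simpa [dimSys] using hf i k v)

theorem dimGroupLift_dimGroupOf (C : Matrix ι ι ℤ) {M : Type*} [AddCommGroup M] [Module ℤ M]
    (f : ℕ → (ι → ℤ) →ₗ[ℤ] M)
    (hf : ∀ j k v, f (j + k) ((C ^ k).mulVec v) = f j v) (j : ℕ) (v : ι → ℤ) :
    dimGroupLift C f hf (dimGroupOf C j v) = f j v :=
  Module.DirectLimit.lift_of _ _ _

open Kronecker in
theorem kronecker_pow (A : Matrix ι ι ℤ) (B : Matrix κ κ ℤ) (k : ℕ) :
    (A ⊗ₖ B) ^ k = (A ^ k) ⊗ₖ (B ^ k) := by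
  induction k with
  | zero => simp
  | succ k ih => rw [pow_succ, ih, pow_succ, pow_succ, Matrix.mul_kronecker_mul]

open Kronecker in
theorem dimGroupOf_piTensorEquiv_pow (A : Matrix ι ι ℤ) (B : Matrix κ κ ℤ) (j k : ℕ)
    (x : ι → ℤ) (y : κ → ℤ) :
    dimGroupOf (A ⊗ₖ B) (j + k)
        (piTensorEquiv ι κ ((A ^ k).mulVec x ⊗ₜ (B ^ k).mulVec y)) =
      dimGroupOf (A ⊗ₖ B) j (piTensorEquiv ι κ (x ⊗ₜ y)) := by
  rw [← kronecker_mulVec_piTensorEquiv_tmul, ← kronecker_pow, dimGroupOf_pow_mulVec]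

theorem linearMap_pi_prod_ext {M : Type*} [AddCommGroup M] [Module ℤ M]
    {f g : (ι × κ → ℤ) →ₗ[ℤ] M}
    (h : ∀ x y, f (piTensorEquiv ι κ (x ⊗ₜ y)) = g (piTensorEquiv ι κ (x ⊗ₜ y))) : f = g := by
  have : f ∘ₗ (piTensorEquiv ι κ).toLinearMap = g ∘ₗ (piTensorEquiv ι κ).toLinearMap :=
    TensorProduct.ext' h
  ext1 p
  ext
  simpa using LinearMap.congr_fun this ((piTensorEquiv ι κ).symm (Pi.single p 1))

open Kronecker in
/-- The map `D(A ⊗ B) → D(A) ⊗ D(B)`, `[x ⊗ y, j] ↦ [x, j] ⊗ [y, j]`. -/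
noncomputable def dimGroupKroneckerHom (A : Matrix ι ι ℤ) (B : Matrix κ κ ℤ) :
    dimGroup (A ⊗ₖ B) →ₗ[ℤ] dimGroup A ⊗[ℤ] dimGroup B :=
  dimGroupLift (A ⊗ₖ B)
    (fun j => TensorProduct.map (dimGroupOf A j) (dimGroupOf B j) ∘ₗ
      (piTensorEquiv ι κ).symm.toLinearMap)
    (by
      intro j k
      refine LinearMap.congr_fun (f := (TensorProduct.map (dimGroupOf A (j + k))
        (dimGroupOf B (j + k)) ∘ₗ (piTensorEquiv ι κ).symm.toLinearMap) ∘ₗ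
          ((A ⊗ₖ B) ^ k).mulVecLin) (linearMap_pi_prod_ext fun x y => ?_)
      change TensorProduct.map (dimGroupOf A (j + k)) (dimGroupOf B (j + k))
        ((piTensorEquiv ι κ).symm
          (((A ⊗ₖ B) ^ k).mulVec (piTensorEquiv ι κ (x ⊗ₜ y)))) =
        TensorProduct.map (dimGroupOf A j) (dimGroupOf B j)
          ((piTensorEquiv ι κ).symm (piTensorEquiv ι κ (x ⊗ₜ y)))
      rw [kronecker_pow, kronecker_mulVec_piTensorEquiv_tmul, LinearEquiv.symm_apply_apply,
        LinearEquiv.symm_apply_apply, TensorProduct.map_tmul, TensorProduct.map_tmul,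
        dimGroupOf_pow_mulVec, dimGroupOf_pow_mulVec])

open Kronecker in
theorem dimGroupKroneckerHom_dimGroupOf (A : Matrix ι ι ℤ) (B : Matrix κ κ ℤ) (j : ℕ)
    (x : ι → ℤ) (y : κ → ℤ) :
    dimGroupKroneckerHom A B (dimGroupOf (A ⊗ₖ B) j (piTensorEquiv ι κ (x ⊗ₜ y))) =
      dimGroupOf A j x ⊗ₜ dimGroupOf B j y := by
  refine (dimGroupLift_dimGroupOf _ _ _ _ _).trans ?_
  change TensorProduct.map (dimGroupOf A j) (dimGroupOf B j)
    ((piTensorEquiv ι κ).symm (piTensorEquiv ι κ (x ⊗ₜ y))) = _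
  rw [LinearEquiv.symm_apply_apply, TensorProduct.map_tmul]

open Kronecker in
/-- The bilinear map `(x, y) ↦ [A ^ j x ⊗ B ^ i y, i + j]`. -/
noncomputable def dimGroupPairing (A : Matrix ι ι ℤ) (B : Matrix κ κ ℤ) (i j : ℕ) :
    (ι → ℤ) →ₗ[ℤ] (κ → ℤ) →ₗ[ℤ] dimGroup (A ⊗ₖ B) :=
  ((TensorProduct.mk ℤ (ι → ℤ) (κ → ℤ)).compl₁₂ (A ^ j).mulVecLin (B ^ i).mulVecLin).compr₂
    (dimGroupOf (A ⊗ₖ B) (i + j) ∘ₗ (piTensorEquiv ι κ).toLinearMap)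

open Kronecker in
theorem dimGroupPairing_apply (A : Matrix ι ι ℤ) (B : Matrix κ κ ℤ) (i j : ℕ)
    (x : ι → ℤ) (y : κ → ℤ) :
    dimGroupPairing A B i j x y = dimGroupOf (A ⊗ₖ B) (i + j)
      (piTensorEquiv ι κ ((A ^ j).mulVec x ⊗ₜ (B ^ i).mulVec y)) :=
  rfl

theorem dimGroupPairing_pow_right (A : Matrix ι ι ℤ) (B : Matrix κ κ ℤ) (i j k : ℕ)
    (x : ι → ℤ) (y : κ → ℤ) :
    dimGroupPairing A B i (j + k) x ((B ^ k).mulVec y) = dimGroupPairing A B i j x y := by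
  rw [dimGroupPairing_apply, dimGroupPairing_apply, ← dimGroupOf_piTensorEquiv_pow A B (i + j) k,
    add_assoc i j k]
  simp only [Matrix.mulVec_mulVec, ← pow_add, add_comm]

theorem dimGroupPairing_pow_left (A : Matrix ι ι ℤ) (B : Matrix κ κ ℤ) (i j k : ℕ)
    (x : ι → ℤ) (y : κ → ℤ) :
    dimGroupPairing A B (i + k) j ((A ^ k).mulVec x) y = dimGroupPairing A B i j x y := by
  rw [dimGroupPairing_apply, dimGroupPairing_apply, ← dimGroupOf_piTensorEquiv_pow A B (i + j) k,
    add_right_comm i k j]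
  simp only [Matrix.mulVec_mulVec, ← pow_add, add_comm]

open Kronecker in
/-- The bilinear map `(x, [y, j]) ↦ [A ^ j x ⊗ B ^ i y, i + j]`. -/
noncomputable def dimGroupPairingRight (A : Matrix ι ι ℤ) (B : Matrix κ κ ℤ) (i : ℕ) :
    (ι → ℤ) →ₗ[ℤ] dimGroup B →ₗ[ℤ] dimGroup (A ⊗ₖ B) :=
  (dimGroupLift B (fun j => (dimGroupPairing A B i j).flip) fun j k y =>
    LinearMap.ext fun x => dimGroupPairing_pow_right A B i j k x y).flip

theorem dimGroupPairingRight_dimGroupOf (A : Matrix ι ι ℤ) (B : Matrix κ κ ℤ) (i j : ℕ)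
    (x : ι → ℤ) (y : κ → ℤ) :
    dimGroupPairingRight A B i x (dimGroupOf B j y) = dimGroupPairing A B i j x y := by
  rw [dimGroupPairingRight, LinearMap.flip_apply, dimGroupLift_dimGroupOf, LinearMap.flip_apply]

theorem dimGroupPairingRight_pow (A : Matrix ι ι ℤ) (B : Matrix κ κ ℤ) (i k : ℕ)
    (x : ι → ℤ) :
    dimGroupPairingRight A B (i + k) ((A ^ k).mulVec x) = dimGroupPairingRight A B i x := by
  refine dimGroup_hom_ext fun j => LinearMap.ext fun y => ?_
  rw [LinearMap.comp_apply, LinearMap.comp_apply, dimGroupPairingRight_dimGroupOf,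
    dimGroupPairingRight_dimGroupOf, dimGroupPairing_pow_left]

open Kronecker in
/-- The map `D(A) ⊗ D(B) → D(A ⊗ B)`, `[x, i] ⊗ [y, j] ↦ [A ^ j x ⊗ B ^ i y, i + j]`. -/
noncomputable def dimGroupKroneckerInv (A : Matrix ι ι ℤ) (B : Matrix κ κ ℤ) :
    dimGroup A ⊗[ℤ] dimGroup B →ₗ[ℤ] dimGroup (A ⊗ₖ B) :=
  TensorProduct.lift (dimGroupLift A (dimGroupPairingRight A B) (dimGroupPairingRight_pow A B))

theorem dimGroupKroneckerInv_tmul (A : Matrix ι ι ℤ) (B : Matrix κ κ ℤ) (i j : ℕ)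
    (x : ι → ℤ) (y : κ → ℤ) :
    dimGroupKroneckerInv A B (dimGroupOf A i x ⊗ₜ dimGroupOf B j y) =
      dimGroupPairing A B i j x y := by
  change dimGroupLift A (dimGroupPairingRight A B) (dimGroupPairingRight_pow A B)
    (dimGroupOf A i x) (dimGroupOf B j y) = _
  rw [dimGroupLift_dimGroupOf, dimGroupPairingRight_dimGroupOf]

open Kronecker in
/-- The isomorphism `D(A ⊗ B) ≃ D(A) ⊗ D(B)`. -/
noncomputable def dimGroupKroneckerEquiv (A : Matrix ι ι ℤ) (B : Matrix κ κ ℤ) :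
    dimGroup (A ⊗ₖ B) ≃ₗ[ℤ] dimGroup A ⊗[ℤ] dimGroup B :=
  LinearEquiv.ofLinearMap (dimGroupKroneckerHom A B) (dimGroupKroneckerInv A B)
    (by
      refine TensorProduct.ext <| dimGroup_hom_ext fun i => LinearMap.ext fun x =>
        dimGroup_hom_ext fun j => LinearMap.ext fun y => ?_
      change dimGroupKroneckerHom A B (dimGroupKroneckerInv A B
        (dimGroupOf A i x ⊗ₜ dimGroupOf B j y)) = dimGroupOf A i x ⊗ₜ dimGroupOf B j y
      rw [dimGroupKroneckerInv_tmul, dimGroupPairing_apply, dimGroupKroneckerHom_dimGroupOf,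
        dimGroupOf_pow_mulVec, add_comm i j, dimGroupOf_pow_mulVec])
    (by
      refine dimGroup_hom_ext fun j => linearMap_pi_prod_ext fun x y => ?_
      simp only [LinearMap.comp_apply, LinearMap.id_apply]
      rw [dimGroupKroneckerHom_dimGroupOf, dimGroupKroneckerInv_tmul, dimGroupPairing_apply,
        dimGroupOf_piTensorEquiv_pow])

open Kronecker in
theorem dimGroupKroneckerHom_comp_dimShift (A : Matrix ι ι ℤ) (B : Matrix κ κ ℤ) :
    dimGroupKroneckerHom A B ∘ₗ dimShift (A ⊗ₖ B) =
      TensorProduct.map (dimShift A) (dimShift B) ∘ₗ dimGroupKroneckerHom A B := by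
  refine dimGroup_hom_ext fun j => linearMap_pi_prod_ext fun x y => ?_
  change dimGroupKroneckerHom A B (dimShift (A ⊗ₖ B)
      (dimGroupOf (A ⊗ₖ B) j (piTensorEquiv ι κ (x ⊗ₜ y)))) =
    TensorProduct.map (dimShift A) (dimShift B)
      (dimGroupKroneckerHom A B (dimGroupOf (A ⊗ₖ B) j (piTensorEquiv ι κ (x ⊗ₜ y))))
  rw [dimShift_dimGroupOf, kronecker_mulVec_piTensorEquiv_tmul,
    dimGroupKroneckerHom_dimGroupOf, dimGroupKroneckerHom_dimGroupOf, TensorProduct.map_tmul,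
    dimShift_dimGroupOf, dimShift_dimGroupOf]

end DimGroupTensor

open Kronecker in
/-- Künneth for dimension groups: `D(A ⊗ B) ≅ D(A) ⊗_ℤ D(B)`, compatibly with the
induced automorphisms `(A ⊗ B)_*` and `A_* ⊗ B_*`. -/
theorem dimGroup_kronecker (n m : ℕ)
    (A : Matrix (Fin n) (Fin n) ℤ) (B : Matrix (Fin m) (Fin m) ℤ) :
    ∃ e : dimGroup (A ⊗ₖ B) ≃ₗ[ℤ] TensorProduct ℤ (dimGroup A) (dimGroup B),
      ∀ x : dimGroup (A ⊗ₖ B),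
        e (dimShift (A ⊗ₖ B) x) = TensorProduct.map (dimShift A) (dimShift B) (e x) := by
  exact ⟨dimGroupKroneckerEquiv A B,
    LinearMap.congr_fun (dimGroupKroneckerHom_comp_dimShift A B)⟩
end

section
/- Let A be an r×r integer matrix and let ℛ_A = ⋂_{k≥1} A^k(ℚ^r) be the eventual range of A, a ℚ-linear subspace of ℚ^r. Then A restricts to a linear automorphism A^× of ℛ_A, there is an isomorphism of ℚ-vector spaces ℛ_A ≅ D(A) ⊗_ℤ ℚ, and this isomorphism intertwines A^× with the automorphism A_* ⊗ id_ℚ of D(A) ⊗_ℤ ℚ. -/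
open Module TensorProduct

namespace dimGroup

variable {ι : Type} [Fintype ι] [DecidableEq ι] (C : Matrix ι ι ℤ)

/-- The class `[v, j]` in the dimension group, as a linear map in `v`. -/
noncomputable def of (j : ℕ) : (ι → ℤ) →ₗ[ℤ] dimGroup C :=
  Module.DirectLimit.of ℤ ℕ (fun _ : ℕ => ι → ℤ) (dimSys C) j

theorem of_add_pow_mulVecLin (j k : ℕ) (v : ι → ℤ) :
    of C (j + k) ((C ^ k).mulVecLin v) = of C j v := by
  have h := Module.DirectLimit.of_f (R := ℤ) (G := fun _ : ℕ => ι → ℤ) (f := dimSys C)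
    (hij := Nat.le_add_right j k) (x := v)
  simp only [dimSys, Nat.add_sub_cancel_left] at h
  exact h

theorem exists_of (z : dimGroup C) : ∃ j v, of C j v = z :=
  Module.DirectLimit.exists_of z

theorem dimShift_of (j : ℕ) (v : ι → ℤ) :
    dimShift C (of C j v) = of C j (C.mulVecLin v) :=
  Module.DirectLimit.lift_of _ _ _

variable {C} {V : Type*} [AddCommGroup V] [Module ℚ V]

theorem map_pow_mulVecLin {B : V ≃ₗ[ℚ] V} {P : (ι → ℤ) →ₗ[ℤ] V}
    (hP : ∀ v, P (C.mulVecLin v) = B (P v)) (k : ℕ) (v : ι → ℤ) :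
    P ((C ^ k).mulVecLin v) = (B ^ k) (P v) := by
  induction k generalizing v with
  | zero => simp
  | succ k ih =>
    rw [pow_succ, Matrix.mulVecLin_mul, LinearMap.comp_apply, ih, hP, pow_succ]
    rfl

/-- The map `D(C) → V`, `[v, j] ↦ B⁻ʲ (P v)`, induced by a map `P` intertwining `C` with an
automorphism `B` of `V`. -/
noncomputable def lift (B : V ≃ₗ[ℚ] V) (P : (ι → ℤ) →ₗ[ℤ] V)
    (hP : ∀ v, P (C.mulVecLin v) = B (P v)) : dimGroup C →ₗ[ℤ] V :=
  Module.DirectLimit.lift ℤ ℕ (fun _ : ℕ => ι → ℤ) (dimSys C)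
    (fun j => ((B ^ j).symm.toLinearMap.restrictScalars ℤ).comp P)
    (by
      intro i j hij v
      obtain ⟨k, rfl⟩ := Nat.exists_eq_add_of_le hij
      change (B ^ (i + k)).symm (P ((C ^ (i + k - i)).mulVecLin v)) = (B ^ i).symm (P v)
      rw [Nat.add_sub_cancel_left, map_pow_mulVecLin hP, LinearEquiv.symm_apply_eq,
        add_comm, pow_add, LinearEquiv.mul_apply, LinearEquiv.apply_symm_apply])

section Lift

variable {B : V ≃ₗ[ℚ] V} {P : (ι → ℤ) →ₗ[ℤ] V} (hP : ∀ v, P (C.mulVecLin v) = B (P v))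

theorem lift_of (j : ℕ) (v : ι → ℤ) : lift B P hP (of C j v) = (B ^ j).symm (P v) :=
  Module.DirectLimit.lift_of _ _ _

theorem lift_dimShift (d : dimGroup C) : lift B P hP (dimShift C d) = B (lift B P hP d) := by
  obtain ⟨j, v, rfl⟩ := exists_of C d
  rw [dimShift_of, lift_of, lift_of, hP, LinearEquiv.symm_apply_eq, ← LinearEquiv.mul_apply,
    ← pow_succ, pow_succ', LinearEquiv.mul_apply, LinearEquiv.apply_symm_apply]

theorem lift_injective (hker : ∀ v, P v = 0 → ∃ k, (C ^ k).mulVecLin v = 0) :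
    Function.Injective (lift B P hP) := by
  rw [injective_iff_map_eq_zero]
  intro d hd
  obtain ⟨j, v, rfl⟩ := exists_of C d
  rw [lift_of, LinearEquiv.map_eq_zero_iff] at hd
  obtain ⟨k, hk⟩ := hker v hd
  rw [← of_add_pow_mulVecLin C j k, hk, map_zero]

theorem isBaseChange_lift (hker : ∀ v, P v = 0 → ∃ k, (C ^ k).mulVecLin v = 0)
    (hsurj : ∀ y, ∃ s : ℤ, s ≠ 0 ∧ ∃ v, P v = s • y) : IsBaseChange ℚ (lift B P hP) := by
  have : IsLocalizedModule (nonZeroDivisors ℤ) (lift B P hP) :=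
    { map_units := fun s => by
        have hs : ((s : ℤ) : ℚ) ≠ 0 := Int.cast_ne_zero.2 (nonZeroDivisors.coe_ne_zero s)
        rw [Module.End.isUnit_iff]
        refine ⟨fun x y h => ?_, fun y => ⟨((s : ℤ) : ℚ)⁻¹ • y, ?_⟩⟩
        · simp only [Module.algebraMap_end_apply, ← Int.cast_smul_eq_zsmul ℚ] at h
          exact smul_right_injective V hs h
        · simp only [Module.algebraMap_end_apply, ← Int.cast_smul_eq_zsmul ℚ]
          exact smul_inv_smul₀ hs y
      surj := fun y => by
        obtain ⟨s, hs, v, hv⟩ := hsurj y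
        refine ⟨(of C 0 v, ⟨s, mem_nonZeroDivisors_of_ne_zero hs⟩), ?_⟩
        rw [lift_of, hv]
        rfl
      exists_of_eq := fun h => ⟨1, by rw [lift_injective hP hker h]⟩ }
  exact IsLocalizedModule.isBaseChange (nonZeroDivisors ℤ) ℚ _

end Lift

/-- If `P : ℤ^ι → V` intertwines `C` with an automorphism `B` of a rational vector space `V`,
its kernel is eventually killed by `C`, and its image spans `V` up to denominators, then
`(V, B)` is isomorphic to `(ℚ ⊗ D(C), id ⊗ C_*)`. -/
theorem exists_equiv_tensor {B : V ≃ₗ[ℚ] V} {P : (ι → ℤ) →ₗ[ℤ] V}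
    (hP : ∀ v, P (C.mulVecLin v) = B (P v))
    (hker : ∀ v, P v = 0 → ∃ k, (C ^ k).mulVecLin v = 0)
    (hsurj : ∀ y, ∃ s : ℤ, s ≠ 0 ∧ ∃ v, P v = s • y) :
    ∃ e : V ≃ₗ[ℚ] ℚ ⊗[ℤ] dimGroup C,
      ∀ x, e (B x) = LinearMap.lTensor ℚ (dimShift C) (e x) := by
  have hb := isBaseChange_lift hP hker hsurj
  refine ⟨hb.equiv.symm, fun x => ?_⟩
  rw [LinearEquiv.symm_apply_eq]
  obtain ⟨t, rfl⟩ := hb.equiv.surjective x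
  rw [LinearEquiv.symm_apply_apply]
  induction t using TensorProduct.induction_on with
  | zero => simp
  | tmul q d =>
    rw [LinearMap.lTensor_tmul, IsBaseChange.equiv_tmul, IsBaseChange.equiv_tmul,
      lift_dimShift, map_smul]
  | add s t hs ht => simp only [map_add, hs, ht]

end dimGroup

section EventualRange

variable {K V : Type*} [Field K] [AddCommGroup V] [Module K V] [FiniteDimensional K V]

theorem exists_range_pow_eq_iInf_range_pow_succ (f : Module.End K V) :
    ∃ n, ∀ m ≥ n, LinearMap.range (f ^ m) = ⨅ k : ℕ, LinearMap.range (f ^ (k + 1)) := by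
  have hanti : Antitone fun k : ℕ => LinearMap.range (f ^ k) := f.iterateRange.monotone
  have h : ⨅ k : ℕ, LinearMap.range (f ^ (k + 1)) = ⨅ k : ℕ, LinearMap.range (f ^ k) :=
    le_antisymm (le_iInf fun k => (iInf_le _ k).trans (hanti k.le_succ))
      (le_iInf fun k => iInf_le _ (k + 1))
  obtain ⟨n, hn⟩ := Filter.eventually_atTop.1 f.eventually_iInf_range_pow_eq
  exact ⟨n, fun m hm => by rw [h, hn m hm]⟩

theorem bijOn_range_pow (f : Module.End K V) (n : ℕ)
    (h : LinearMap.range (f ^ (n + 1)) = LinearMap.range (f ^ n)) :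
    Set.BijOn f (LinearMap.range (f ^ n) : Set V) (LinearMap.range (f ^ n) : Set V) := by
  have hmap : (LinearMap.range (f ^ n)).map f = LinearMap.range (f ^ n) := by
    rw [← LinearMap.range_comp, ← Module.End.mul_eq_comp, ← pow_succ', h]
  have hmaps : ∀ x ∈ LinearMap.range (f ^ n), f x ∈ LinearMap.range (f ^ n) :=
    fun x hx => hmap.le (Submodule.mem_map_of_mem hx)
  have hsurj : Function.Surjective (f.restrict hmaps) := by
    rintro ⟨y, hy⟩
    obtain ⟨x, hx, rfl⟩ := hmap.ge hy
    exact ⟨⟨x, hx⟩, rfl⟩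
  refine ⟨hmaps, fun x hx y hy hxy => ?_, fun y hy => hmap.ge hy⟩
  have := LinearMap.injective_iff_surjective.2 hsurj (a₁ := ⟨x, hx⟩) (a₂ := ⟨y, hy⟩)
    (Subtype.ext hxy)
  exact congrArg Subtype.val this

end EventualRange

/-- The inclusion `ℤ^ι → ℚ^ι`. -/
def intVecCast (ι : Type) : (ι → ℤ) →ₗ[ℤ] (ι → ℚ) :=
  (Algebra.linearMap ℤ ℚ).compLeft ι

theorem intVecCast_apply {ι : Type} (v : ι → ℤ) (i : ι) : intVecCast ι v i = (v i : ℚ) := rfl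

theorem intVecCast_injective (ι : Type) : Function.Injective (intVecCast ι) :=
  fun _ _ h => funext fun i => Int.cast_injective (congrFun h i)

theorem exists_intVecCast_eq_smul {ι : Type} [Finite ι] (w : ι → ℚ) :
    ∃ s : ℤ, s ≠ 0 ∧ ∃ v, intVecCast ι v = s • w := by
  obtain ⟨b, hb⟩ := IsLocalization.exist_integer_multiples_of_finite (nonZeroDivisors ℤ) w
  choose v hv using hb
  exact ⟨b, nonZeroDivisors.coe_ne_zero b, v, funext hv⟩

theorem pow_intVecCast {ι : Type} [Fintype ι] [DecidableEq ι] (A : Matrix ι ι ℤ) (k : ℕ)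
    (v : ι → ℤ) :
    ((A.map (fun z : ℤ => (z : ℚ))).mulVecLin ^ k) (intVecCast ι v) =
      intVecCast ι ((A ^ k).mulVecLin v) := by
  induction k generalizing v with
  | zero => simp
  | succ k ih =>
    have h1 : (A.map (fun z : ℤ => (z : ℚ))).mulVecLin (intVecCast ι v) =
        intVecCast ι (A.mulVecLin v) := by
      ext i
      simp [intVecCast_apply, Matrix.mulVec, dotProduct]
    rw [pow_succ, Module.End.mul_apply, h1, ih, pow_succ, Matrix.mulVecLin_mul,
      LinearMap.comp_apply]

open TensorProduct in
/-- The eventual range `ℛ_A = ⋂_{k ≥ 1} A^k (ℚ^r)` of an integer matrix `A`: `A`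
restricts to a linear automorphism of `ℛ_A`, and there is an isomorphism of ℚ-vector
spaces `ℛ_A ≅ ℚ ⊗_ℤ D(A)` intertwining the restriction of `A` with `id_ℚ ⊗ A_*`. -/
theorem eventualRange_iso_rational_dimGroup (r : ℕ) (A : Matrix (Fin r) (Fin r) ℤ) :
    ∀ Aq : (Fin r → ℚ) →ₗ[ℚ] (Fin r → ℚ),
      Aq = (A.map (fun z : ℤ => (z : ℚ))).mulVecLin →
    ∀ R : Submodule ℚ (Fin r → ℚ),
      R = ⨅ k : ℕ, LinearMap.range (Aq ^ (k + 1)) →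
    Set.BijOn Aq (R : Set (Fin r → ℚ)) (R : Set (Fin r → ℚ)) ∧
    ∃ e : R ≃ₗ[ℚ] ℚ ⊗[ℤ] dimGroup A,
      ∀ (x : R) (hx : Aq (x : Fin r → ℚ) ∈ R),
        e ⟨Aq (x : Fin r → ℚ), hx⟩ = LinearMap.lTensor ℚ (dimShift A) (e x) := by
  rintro Aq hAq R hR
  obtain ⟨n, hn⟩ := exists_range_pow_eq_iInf_range_pow_succ Aq
  rw [← hR] at hn
  have hRn : LinearMap.range (Aq ^ n) = R := hn n le_rfl
  have hbij : Set.BijOn Aq (R : Set (Fin r → ℚ)) (R : Set (Fin r → ℚ)) := by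
    have := bijOn_range_pow Aq n ((hn _ n.le_succ).trans hRn.symm)
    rwa [hRn] at this
  refine ⟨hbij, ?_⟩
  let B : R ≃ₗ[ℚ] R := LinearEquiv.ofBijective (Aq.restrict hbij.mapsTo) hbij.bijective
  let Q : (Fin r → ℚ) →ₗ[ℚ] R := (Aq ^ n).codRestrict R fun x => hRn.le ⟨x, rfl⟩
  let P : (Fin r → ℤ) →ₗ[ℤ] R := (Q.restrictScalars ℤ).comp (intVecCast (Fin r))
  have hP : ∀ v, P (A.mulVecLin v) = B (P v) := fun v => Subtype.ext <| by
    change (Aq ^ n) (intVecCast _ (A.mulVecLin v)) = Aq ((Aq ^ n) (intVecCast _ v))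
    have h := pow_intVecCast A 1 v
    rw [pow_one, pow_one, ← hAq] at h
    rw [← h, ← Module.End.mul_apply, ← Module.End.mul_apply, ← pow_succ, ← pow_succ']
  obtain ⟨e, he⟩ := dimGroup.exists_equiv_tensor hP
    (fun v hv => ⟨n, intVecCast_injective _ <| by
      rw [← pow_intVecCast, ← hAq, map_zero]
      exact congrArg Subtype.val hv⟩)
    (fun y => by
      obtain ⟨w, hw⟩ := hRn.ge y.2
      obtain ⟨s, hs, v, hv⟩ := exists_intVecCast_eq_smul w
      refine ⟨s, hs, v, Subtype.ext ?_⟩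
      change (Aq ^ n) (intVecCast _ v) = s • (y : Fin r → ℚ)
      rw [hv, map_zsmul, hw])
  exact ⟨e, fun x _ => he x⟩
end
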